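/- For every n ∈ {20, 22, 24, 26, 28, 32}, there is no (3, 8) Hamiltonian bipartite graph of order n; that is, no simple graph on Fin n is simultaneously 3-regular, bipartite, Hamiltonian, and of girth 8. -/

import Mathlib

/-- A `(3, g)` Hamiltonian bipartite graph of order `n`: a simple graph on `Fin n` that is
3-regular (every vertex has exactly 3 neighbours), bipartite (2-colorable), contains a
Hamiltonian cycle, and has girth `g` (as the infimum in `ℕ∞` of its cycle lengths). -/
def IsHamBipartite3 (n g : ℕ) (G : SimpleGraph (Fin n)) : Prop :=
  (∀ v, {w | G.Adj v w}.ncard = 3) ∧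
  G.Colorable 2 ∧
  (∃ (v : Fin n) (c : G.Walk v v), c.IsHamiltonianCycle) ∧
  G.egirth = (g : ℕ∞)


namespace Ham8

lemma b3 : ∀ {a b d : Bool}, a ≠ b → b ≠ d → a = d := by decide

variable {V : Type*} [Fintype V] [DecidableEq V]

lemma no4 {W : Type*} (G : SimpleGraph W) (hg : (8 : ℕ∞) ≤ G.egirth) {a b c d : W}
    (hab : G.Adj a b) (hbc : G.Adj b c) (hcd : G.Adj c d) (hda : G.Adj d a)
    (hac : a ≠ c) (hbd : b ≠ d) : False := by
  rw [SimpleGraph.le_egirth] at hg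
  have h1 := hab.ne
  have h2 := hbc.ne
  have h3 := hcd.ne
  have h4 := hda.ne
  have := hg a (.cons hab (.cons hbc (.cons hcd (.cons hda .nil)))) (by
    simp [SimpleGraph.Walk.isCycle_def, SimpleGraph.Walk.isTrail_def]
    grind)
  simp at this
  norm_cast at this

lemma no6 {W : Type*} (G : SimpleGraph W) (hg : (8 : ℕ∞) ≤ G.egirth) {a b c d e f : W}
    (hab : G.Adj a b) (hbc : G.Adj b c) (hcd : G.Adj c d) (hde : G.Adj d e)
    (hef : G.Adj e f) (hfa : G.Adj f a)
    (hnd : [a, b, c, d, e, f].Nodup) : False := by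
  rw [SimpleGraph.le_egirth] at hg
  simp at hnd
  have := hg a (.cons hab (.cons hbc (.cons hcd (.cons hde (.cons hef (.cons hfa .nil)))))) (by
    simp [SimpleGraph.Walk.isCycle_def, SimpleGraph.Walk.isTrail_def]
    grind)
  simp at this
  norm_cast at this

open Matrix

/-- Pairs completing a walk of length three. -/
def paths (G : SimpleGraph V) [DecidableRel G.Adj] (i j : V) : Finset (V × V) :=
  Finset.univ.filter fun p => G.Adj i p.1 ∧ G.Adj p.1 p.2 ∧ G.Adj p.2 j

lemma cube_apply (G : SimpleGraph V) [DecidableRel G.Adj] (i j : V) :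
    ((G.adjMatrix ℤ) ^ 3) i j = ((paths G i j).card : ℤ) := by
  rw [pow_three, paths, Finset.card_filter, Fintype.sum_prod_type]
  simp only [Matrix.mul_apply, SimpleGraph.adjMatrix_apply, Finset.mul_sum]
  push_cast
  refine Finset.sum_congr rfl fun x _ => Finset.sum_congr rfl fun y _ => ?_
  split_ifs <;> simp_all

lemma paths_nonadj (G : SimpleGraph V) [DecidableRel G.Adj] (hg : (8 : ℕ∞) ≤ G.egirth)
    (c : V → Bool) (hc : ∀ x y, G.Adj x y → c x ≠ c y) (i j : V) (hij : ¬ G.Adj i j) :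
    (paths G i j).card ≤ 1 ∨ c i = c j := by
  by_cases hcc : c i = c j
  · exact Or.inr hcc
  left
  rw [Finset.card_le_one]
  rintro ⟨x, y⟩ h ⟨x', y'⟩ h'
  simp only [paths, Finset.mem_filter, Finset.mem_univ, true_and] at h h'
  obtain ⟨h1, h2, h3⟩ := h
  obtain ⟨h1', h2', h3'⟩ := h'
  by_cases hx : x = x'
  · subst hx
    by_cases hy : y = y'
    · rw [hy]
    · refine (no4 G hg h2 h3 h3'.symm h2'.symm ?_ hy).elim
      rintro rfl
      exact hij h1
  · by_cases hy : y = y'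
    · subst hy
      refine (no4 G hg h1 h2 h2'.symm h1'.symm ?_ hx).elim
      rintro rfl
      exact hij h3
    · refine (no6 G hg h1 h2 h3 h3'.symm h2'.symm h1'.symm ?_).elim
      have a1 := b3 (hc _ _ h1) (hc _ _ h2)
      have a2 := b3 (hc _ _ h1') (hc _ _ h2')
      have a3 := b3 (hc _ _ h2) (hc _ _ h3)
      have a4 := b3 (hc _ _ h2') (hc _ _ h3')
      have a5 : i ≠ y := by rintro rfl; exact hij h3
      have a6 : i ≠ y' := by rintro rfl; exact hij h3'
      have a7 : x ≠ j := by rintro rfl; exact hij h1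
      have a8 : x' ≠ j := by rintro rfl; exact hij h1'
      simp
      grind

lemma paths_same (G : SimpleGraph V) [DecidableRel G.Adj]
    (c : V → Bool) (hc : ∀ x y, G.Adj x y → c x ≠ c y) (i j : V) (hij : c i = c j) :
    (paths G i j).card = 0 := by
  rw [Finset.card_eq_zero, Finset.eq_empty_iff_forall_notMem]
  rintro ⟨x, y⟩ h
  simp only [paths, Finset.mem_filter, Finset.mem_univ, true_and] at h
  exact hc _ _ h.2.2 ((b3 (hc _ _ h.1) (hc _ _ h.2.1)).symm.trans hij)

lemma paths_adj (G : SimpleGraph V) [DecidableRel G.Adj] (hg : (8 : ℕ∞) ≤ G.egirth)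
    (h3 : ∀ v, G.degree v = 3) (i j : V) (hij : G.Adj i j) :
    (paths G i j).card = 5 := by
  have e : paths G i j = (G.neighborFinset i ×ˢ {i}) ∪ ({j} ×ˢ G.neighborFinset j) := by
    ext ⟨x, y⟩
    simp only [paths, Finset.mem_filter, Finset.mem_univ, true_and, Finset.mem_union,
      Finset.mem_product, Finset.mem_singleton, SimpleGraph.mem_neighborFinset]
    constructor
    · rintro ⟨h1, h2, h4⟩
      by_cases hy : y = i
      · exact Or.inl ⟨h1, hy⟩
      · by_cases hx : x = j
        · exact Or.inr ⟨hx, h4.symm⟩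
        · exact (no4 G hg h1 h2 h4 hij.symm (Ne.symm hy) hx).elim
    · rintro (⟨h, rfl⟩ | ⟨rfl, h⟩)
      · exact ⟨h, h.symm, hij⟩
      · exact ⟨hij, h, h.symm⟩
  have e2 : (G.neighborFinset i ×ˢ {i}) ∩ ({j} ×ˢ G.neighborFinset j) = {(j, i)} := by
    ext ⟨x, y⟩
    simp only [Finset.mem_inter, Finset.mem_product, Finset.mem_singleton,
      SimpleGraph.mem_neighborFinset, Prod.mk.injEq]
    constructor
    · rintro ⟨⟨_, h⟩, ⟨h', _⟩⟩
      exact ⟨h', h⟩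
    · rintro ⟨rfl, rfl⟩
      exact ⟨⟨hij, rfl⟩, rfl, hij.symm⟩
  have e3 := Finset.card_union_add_card_inter (G.neighborFinset i ×ˢ {i})
    ({j} ×ˢ G.neighborFinset j)
  rw [← e, e2] at e3
  simp [h3] at e3
  omega

/-- Indicator of different colours. -/
def Bm (c : V → Bool) : Matrix V V ℤ := Matrix.of fun i j => if c i ≠ c j then 1 else 0

/-- Indicator of equal colours. -/
def Cm (c : V → Bool) : Matrix V V ℤ := Matrix.of fun i j => if c i = c j then 1 else 0

/-- Indicator of distance at least five between opposite colours. -/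
def Pm (G : SimpleGraph V) [DecidableRel G.Adj] (c : V → Bool) : Matrix V V ℤ :=
  Bm c - (G.adjMatrix ℤ) ^ 3 + 4 * G.adjMatrix ℤ

lemma Pm_apply (G : SimpleGraph V) [DecidableRel G.Adj] (c : V → Bool) (i j : V) :
    Pm G c i j = (if c i ≠ c j then 1 else 0) - ((paths G i j).card : ℤ)
      + 4 * (if G.Adj i j then 1 else 0) := by
  have : (4 * G.adjMatrix ℤ) = (4 : ℤ) • G.adjMatrix ℤ := by
    rw [zsmul_eq_mul]; rfl
  rw [Pm, Matrix.add_apply, Matrix.sub_apply, cube_apply, this, Matrix.smul_apply]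
  simp [Bm, SimpleGraph.adjMatrix_apply]

lemma rowsum (G : SimpleGraph V) [DecidableRel G.Adj] (h3 : ∀ v, G.degree v = 3) (i : V) :
    ∑ j, G.adjMatrix ℤ i j = 3 := by
  have h := h3 i
  rw [← SimpleGraph.card_neighborFinset_eq_degree, SimpleGraph.neighborFinset_eq_filter] at h
  simp only [SimpleGraph.adjMatrix_apply, Finset.sum_boole]
  exact_mod_cast h

lemma A_symm (G : SimpleGraph V) [DecidableRel G.Adj] (i j : V) :
    G.adjMatrix ℤ i j = G.adjMatrix ℤ j i := by
  simp [SimpleGraph.adjMatrix_apply, G.adj_comm]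

lemma AB (G : SimpleGraph V) [DecidableRel G.Adj] (h3 : ∀ v, G.degree v = 3)
    (c : V → Bool) (hc : ∀ x y, G.Adj x y → c x ≠ c y) :
    G.adjMatrix ℤ * Bm c = 3 * Cm c := by
  have : (3 * Cm c) = (3 : ℤ) • Cm c := by rw [zsmul_eq_mul]; rfl
  ext i j
  rw [this, Matrix.smul_apply, Matrix.mul_apply, smul_eq_mul, ← rowsum G h3 i, Finset.sum_mul]
  refine Finset.sum_congr rfl fun x _ => ?_
  simp only [SimpleGraph.adjMatrix_apply, Bm, Cm, Matrix.of_apply]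
  by_cases h : G.Adj i x
  · have := hc _ _ h
    simp only [h]
    revert this
    cases c i <;> cases c x <;> cases c j <;> simp
  · simp [h]

lemma AC (G : SimpleGraph V) [DecidableRel G.Adj] (h3 : ∀ v, G.degree v = 3)
    (c : V → Bool) (hc : ∀ x y, G.Adj x y → c x ≠ c y) :
    G.adjMatrix ℤ * Cm c = 3 * Bm c := by
  have : (3 * Bm c) = (3 : ℤ) • Bm c := by rw [zsmul_eq_mul]; rfl
  ext i j
  rw [this, Matrix.smul_apply, Matrix.mul_apply, smul_eq_mul, ← rowsum G h3 i, Finset.sum_mul]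
  refine Finset.sum_congr rfl fun x _ => ?_
  simp only [SimpleGraph.adjMatrix_apply, Bm, Cm, Matrix.of_apply]
  by_cases h : G.Adj i x
  · have := hc _ _ h
    simp only [h]
    revert this
    cases c i <;> cases c x <;> cases c j <;> simp
  · simp [h]

lemma BT (c : V → Bool) : (Bm c)ᵀ = Bm c := by
  ext i j; simp [Bm, eq_comm]

lemma CT (c : V → Bool) : (Cm c)ᵀ = Cm c := by
  ext i j; simp [Cm, eq_comm]

lemma BA (G : SimpleGraph V) [DecidableRel G.Adj] (h3 : ∀ v, G.degree v = 3)
    (c : V → Bool) (hc : ∀ x y, G.Adj x y → c x ≠ c y) :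
    Bm c * G.adjMatrix ℤ = G.adjMatrix ℤ * Bm c := by
  have h := congrArg Matrix.transpose (AB G h3 c hc)
  have : (3 * Cm c) = (3 : ℤ) • Cm c := by rw [zsmul_eq_mul]; rfl
  rw [AB G h3 c hc, this]
  rw [this, Matrix.transpose_mul, BT, Matrix.transpose_smul, CT,
    SimpleGraph.transpose_adjMatrix] at h
  exact h

lemma PT (G : SimpleGraph V) [DecidableRel G.Adj] (c : V → Bool) : (Pm G c)ᵀ = Pm G c := by
  have : (4 * G.adjMatrix ℤ) = (4 : ℤ) • G.adjMatrix ℤ := by rw [zsmul_eq_mul]; rfl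
  rw [Pm, this, Matrix.transpose_add, Matrix.transpose_sub, BT, Matrix.transpose_pow,
    Matrix.transpose_smul, SimpleGraph.transpose_adjMatrix]

/-- Twice the row sum of the opposite-colour matrix is the order. -/
lemma B_rowsum (G : SimpleGraph V) [DecidableRel G.Adj] (h3 : ∀ v, G.degree v = 3)
    (c : V → Bool) (hc : ∀ x y, G.Adj x y → c x ≠ c y) (i : V) :
    2 * ∑ j, Bm c i j = Fintype.card V := by
  let s : V → ℤ := fun v => if c v then 1 else -1
  have hs : ∑ v, s v = 0 := by
    have h1 : ∑ x, ∑ y, G.adjMatrix ℤ x y * s x = 3 * ∑ v, s v := by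
      rw [Finset.mul_sum]
      refine Finset.sum_congr rfl fun x _ => ?_
      rw [← Finset.sum_mul, rowsum G h3]
    have h2 : ∑ x, ∑ y, G.adjMatrix ℤ x y * s x = -(3 * ∑ v, s v) := by
      rw [Finset.sum_comm, Finset.mul_sum, ← Finset.sum_neg_distrib]
      refine Finset.sum_congr rfl fun y _ => ?_
      rw [← rowsum G h3 y, Finset.sum_mul, ← Finset.sum_neg_distrib]
      refine Finset.sum_congr rfl fun x _ => ?_
      rw [A_symm G x y]
      simp only [SimpleGraph.adjMatrix_apply, s]
      by_cases h : G.Adj y x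
      · have := hc _ _ h
        simp only [h]
        revert this
        cases c y <;> cases c x <;> simp
      · simp [h]
    linarith
  have h : ∀ j, 2 * Bm c i j = 1 - s i * s j := by
    intro j
    simp only [Bm, Matrix.of_apply, s]
    cases c i <;> cases c j <;> simp
  rw [Finset.mul_sum, Finset.sum_congr rfl fun j _ => h j, Finset.sum_sub_distrib,
    ← Finset.mul_sum, hs]
  simp

lemma A3_rowsum (G : SimpleGraph V) [DecidableRel G.Adj] (h3 : ∀ v, G.degree v = 3) (i : V) :
    ∑ j, ((G.adjMatrix ℤ) ^ 3) i j = 27 := by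
  have key : ∀ M : Matrix V V ℤ, ∀ r : ℤ, (∀ i, ∑ j, M i j = r) →
      ∀ i, ∑ j, (G.adjMatrix ℤ * M) i j = 3 * r := by
    intro M r hM i
    simp only [Matrix.mul_apply]
    rw [Finset.sum_comm, ← rowsum G h3 i, Finset.sum_mul]
    refine Finset.sum_congr rfl fun x _ => ?_
    rw [← Finset.mul_sum, hM]
  rw [pow_three]
  rw [key _ 9 (fun i => by rw [key _ 3 (rowsum G h3)]; norm_num)]
  norm_num

lemma P_rowsum (G : SimpleGraph V) [DecidableRel G.Adj] (h3 : ∀ v, G.degree v = 3)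
    (c : V → Bool) (hc : ∀ x y, G.Adj x y → c x ≠ c y) (i : V) :
    2 * ∑ j, Pm G c i j = Fintype.card V - 30 := by
  have : (4 * G.adjMatrix ℤ) = (4 : ℤ) • G.adjMatrix ℤ := by rw [zsmul_eq_mul]; rfl
  have hB := B_rowsum G h3 c hc i
  have h27 := A3_rowsum G h3 i
  have h1 := rowsum G h3 i
  simp only [Pm, this, Matrix.add_apply, Matrix.sub_apply, Matrix.smul_apply, smul_eq_mul,
    Finset.sum_add_distrib, Finset.sum_sub_distrib, ← Finset.mul_sum]
  linarith

lemma P_nonneg (G : SimpleGraph V) [DecidableRel G.Adj] (hg : (8 : ℕ∞) ≤ G.egirth)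
    (h3 : ∀ v, G.degree v = 3)
    (c : V → Bool) (hc : ∀ x y, G.Adj x y → c x ≠ c y) (i j : V) : 0 ≤ Pm G c i j := by
  rw [Pm_apply]
  by_cases h : G.Adj i j
  · simp [h, hc _ _ h, paths_adj G hg h3 i j h]
  · by_cases h' : c i = c j
    · simp [h, h', paths_same G c hc i j h']
    · have := (paths_nonadj G hg c hc i j h).resolve_right h'
      simp [h, h']
      exact this

lemma P_same (G : SimpleGraph V) [DecidableRel G.Adj]
    (c : V → Bool) (hc : ∀ x y, G.Adj x y → c x ≠ c y) (i j : V) (h' : c i = c j) :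
    Pm G c i j = 0 := by
  have h : ¬ G.Adj i j := fun h => hc _ _ h h'
  simp [Pm_apply, h, h', paths_same G c hc i j h']

lemma P_adj (G : SimpleGraph V) [DecidableRel G.Adj] (hg : (8 : ℕ∞) ≤ G.egirth)
    (h3 : ∀ v, G.degree v = 3)
    (c : V → Bool) (hc : ∀ x y, G.Adj x y → c x ≠ c y) (i j : V) (h : G.Adj i j) :
    Pm G c i j = 0 := by
  simp [Pm_apply, h, hc _ _ h, paths_adj G hg h3 i j h]

lemma perm_row (f : V → ℤ) (h0 : ∀ j, 0 ≤ f j) (h1 : ∑ j, f j = 1) :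
    ∃ k, ∀ j, f j = if j = k then 1 else 0 := by
  have : ∃ k, f k ≠ 0 := by
    by_contra! h
    simp [h] at h1
  obtain ⟨k, hk⟩ := this
  have hk0 := h0 k
  have hk1 : 1 ≤ f k := by omega
  have hs := Finset.add_sum_erase Finset.univ f (Finset.mem_univ k)
  have hn : 0 ≤ ∑ x ∈ Finset.univ.erase k, f x := Finset.sum_nonneg fun x _ => h0 x
  have hz : ∑ x ∈ Finset.univ.erase k, f x = 0 := by omega
  rw [Finset.sum_eq_zero_iff_of_nonneg fun x _ => h0 x] at hz
  refine ⟨k, fun j => ?_⟩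
  split_ifs with h
  · subst h; omega
  · exact hz j (by simp [h])

lemma main (G : SimpleGraph V) [DecidableRel G.Adj] (hg : (8 : ℕ∞) ≤ G.egirth)
    (h3 : ∀ v, G.degree v = 3)
    (c : V → Bool) (hc : ∀ x y, G.Adj x y → c x ≠ c y) (hV : Fintype.card V = 32) : False := by
  have hrow : ∀ i, ∃ k, ∀ j, Pm G c i j = if j = k then 1 else 0 := fun i =>
    perm_row _ (P_nonneg G hg h3 c hc i) (by
      have := P_rowsum G h3 c hc i
      rw [hV] at this
      norm_num at this
      linarith)
  choose σ hσ using hrow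
  have hcσ : ∀ i, c i ≠ c (σ i) := fun i h => by
    have := P_same G c hc i (σ i) h
    simp [hσ] at this
  have hsymm : ∀ i j, Pm G c i j = Pm G c j i := fun i j =>
    congrFun (congrFun (PT G c) j) i
  have hσσ : ∀ i, σ (σ i) = i := fun i => by
    have := hsymm (σ i) i
    rw [hσ, hσ] at this
    simp at this
    exact this.symm
  have hmul : ∀ M : Matrix V V ℤ, ∀ i j, (Pm G c * M) i j = M (σ i) j := by
    intro M i j
    simp [Matrix.mul_apply, hσ]
  have hPP : Pm G c * Pm G c = 1 := by
    ext i j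
    rw [hmul, hσ, hσσ, Matrix.one_apply]
    simp [eq_comm]
  have hPB : Pm G c * Bm c = Cm c := by
    ext i j
    rw [hmul]
    have := hcσ i
    simp only [Bm, Cm, Matrix.of_apply]
    revert this
    cases c i <;> cases c (σ i) <;> cases c j <;> simp
  have hBA := BA G h3 c hc
  have hAC := AC G h3 c hc
  have hPdef : Pm G c = Bm c - (G.adjMatrix ℤ) ^ 3 + 4 * G.adjMatrix ℤ := rfl
  have htr0 : (Pm G c * G.adjMatrix ℤ).trace = 0 := by
    rw [Matrix.trace]
    refine Finset.sum_eq_zero fun i _ => ?_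
    rw [Matrix.diag_apply, hmul, SimpleGraph.adjMatrix_apply, if_neg]
    intro h
    have := P_adj G hg h3 c hc i (σ i) h.symm
    simp [hσ] at this
  have htrA : ((G.adjMatrix ℤ) ^ 2).trace = 96 := by
    rw [Matrix.trace]
    have : ∀ i, Matrix.diag ((G.adjMatrix ℤ) ^ 2) i = 3 := by
      intro i
      rw [Matrix.diag_apply, sq, Matrix.mul_apply, ← rowsum G h3 i]
      refine Finset.sum_congr rfl fun x _ => ?_
      rw [A_symm G x i]
      simp [SimpleGraph.adjMatrix_apply]
    rw [Finset.sum_congr rfl fun i _ => this i]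
    simp [hV]
  have htrC : (Cm c).trace = 32 := by
    simp [Matrix.trace, Cm, hV]
  have htr1 : (1 : Matrix V V ℤ).trace = 32 := by
    simp [hV]
  generalize hP : Pm G c = P at *
  generalize hA : G.adjMatrix ℤ = A at *
  generalize hB : Bm c = B at *
  generalize hC : Cm c = C at *
  have hcomm : Commute P A := by
    have h1 : Commute B A := hBA
    rw [hPdef]
    exact (h1.sub_left ((Commute.refl A).pow_left 3)).add_left
      ((Commute.ofNat_left 4 A).mul_left (Commute.refl A))
  have hD2 : (P * A) ^ 2 = A ^ 2 := by
    rw [hcomm.mul_pow, sq P, hPP, one_mul]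
  have hD3 : (P * A) ^ 3 = 4 * (P * A) - 1 + C := by
    rw [hcomm.mul_pow, pow_three P, hPP, mul_one]
    have h : P * P = P * B - P * A ^ 3 + P * (4 * A) := by
      nth_rewrite 2 [hPdef]
      rw [mul_add, mul_sub]
    rw [hPP, hPB] at h
    have h4 : P * (4 * A) = 4 * (P * A) := by
      rw [← mul_assoc, ← mul_assoc, (Commute.ofNat_right P 4).eq]
    rw [h4] at h
    rw [h]
    abel
  have hDC : (P * A) * C = 3 * C := by
    rw [mul_assoc, hAC, ← mul_assoc, (Commute.ofNat_right P 3).eq, mul_assoc, hPB]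
  generalize hD : P * A = D at *
  have hD5 : D ^ 5 = 16 * D - A ^ 2 - 4 * 1 + 13 * C := by
    have e : D ^ 5 = D * (D * D ^ 3) := by
      noncomm_ring
    have e1 : D * D ^ 3 = 4 * A ^ 2 - D + 3 * C := by
      rw [hD3, ← hD2, mul_add, mul_sub, hDC]
      noncomm_ring
    have e2 : D * A ^ 2 = D ^ 3 := by
      rw [← hD2]; noncomm_ring
    have e3 : D * (4 * A ^ 2 - D + 3 * C) = 4 * (D * A ^ 2) - D ^ 2 + 3 * (D * C) := by
      noncomm_ring
    rw [e, e1, e3, e2, hDC, hD3, hD2]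
    noncomm_ring
  have ht5 : (D ^ 5).trace = 192 := by
    have e : (16 * D - A ^ 2 - 4 * 1 + 13 * C)
        = (16 : ℤ) • D - A ^ 2 - (4 : ℤ) • (1 : Matrix V V ℤ) + (13 : ℤ) • C := by
      simp only [zsmul_eq_mul]; norm_num
    rw [hD5, e, Matrix.trace_add, Matrix.trace_sub, Matrix.trace_sub, Matrix.trace_smul,
      Matrix.trace_smul, Matrix.trace_smul, htr0, htrA, htrC, htr1]
    norm_num
  have hne : ((192 : ℤ) : ZMod 5) ≠ ((0 : ℤ) : ZMod 5) ^ 5 := by decide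
  have : Fact (Nat.Prime 5) := ⟨by norm_num⟩
  have hf := ZMod.trace_pow_card (p := 5) ((Int.castRingHom (ZMod 5)).mapMatrix D)
  rw [← map_pow] at hf
  have hm : ∀ M : Matrix V V ℤ, ((Int.castRingHom (ZMod 5)).mapMatrix M).trace
      = ((M.trace : ℤ) : ZMod 5) := by
    intro M
    simp [Matrix.trace]
  rw [hm, hm, ht5, htr0] at hf
  exact hne hf

end Ham8

/-- For every `n ∈ {20, 22, 24, 26, 28, 32}` there is no `(3, 8)` Hamiltonian bipartite
graph of order `n`. -/
theorem stmt_8 (n : ℕ) (hn : n ∈ ({20, 22, 24, 26, 28, 32} : Set ℕ)) :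
    ¬ ∃ G : SimpleGraph (Fin n), IsHamBipartite3 n 8 G := by
  classical
  rintro ⟨G, hdeg, ⟨C⟩, -, hgirth⟩
  have hg : (8 : ℕ∞) ≤ G.egirth := by rw [hgirth]; rfl
  have h3 : ∀ v, G.degree v = 3 := by
    intro v
    have := hdeg v
    rw [Set.ncard_eq_toFinset_card'] at this
    rw [← this, ← SimpleGraph.card_neighborFinset_eq_degree]
    congr 1
  let c : Fin n → Bool := fun v => C v = 0
  have hc : ∀ x y, G.Adj x y → c x ≠ c y := by
    intro x y h
    have := C.valid h
    simp only [c]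
    generalize C x = a at *
    generalize C y = b at *
    revert a b
    decide
  by_cases h32 : n = 32
  · exact Ham8.main G hg h3 c hc (by simp [h32])
  · have hlt : 0 < n ∧ n < 30 := by
      simp only [Set.mem_insert_iff, Set.mem_singleton_iff] at hn
      omega
    have h := Ham8.P_rowsum G h3 c hc ⟨0, hlt.1⟩
    have h' : 0 ≤ ∑ j, Ham8.Pm G c ⟨0, hlt.1⟩ j :=
      Finset.sum_nonneg fun j _ => Ham8.P_nonneg G hg h3 c hc _ j
    simp only [Fintype.card_fin] at h
    omega
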